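/- arXiv:1606.06848 — 2 statements merged into one kernel-verified Lean document; each statement's English description precedes it below -/
import Mathlib

section
/- Let a, b > 0, N ∈ ℕ and 0 ≤ ν ≤ 1. Then (1+ν)a − νb + (1/b)·S_N(1−ν; ab, b²) ≤ a^{ν+1} b^{−ν}. -/
open Real Finset

noncomputable def kj (j : ℕ) (ν : ℝ) : ℤ := ⌊(2:ℝ)^(j-1) * ν⌋

noncomputable def rj (j : ℕ) (ν : ℝ) : ℤ := ⌊(2:ℝ)^j * ν⌋

noncomputable def sj (j : ℕ) (ν : ℝ) : ℝ :=
  (-1:ℝ)^(rj j ν) * (2:ℝ)^(j-1) * ν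
    + (-1:ℝ)^(rj j ν + 1) * (⌊((rj j ν : ℝ) + 1)/2⌋ : ℤ)

noncomputable def SS (N : ℕ) (ν a b : ℝ) : ℝ :=
  ∑ j ∈ Finset.Icc 1 N, sj j ν *
    ((b ^ ((2:ℝ)^(j-1) - (kj j ν : ℝ)) * a ^ ((kj j ν : ℝ))) ^ ((1:ℝ)/2^j)
      - (a ^ ((kj j ν : ℝ) + 1) * b ^ ((2:ℝ)^(j-1) - (kj j ν : ℝ) - 1)) ^ ((1:ℝ)/2^j))^2

/-- The weighted geometric mean `exp α ^ t * exp β ^ (1 - t)`. -/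
noncomputable def expMean (α β t : ℝ) : ℝ := exp (t * α + (1 - t) * β)

/-- The value at `ν` of the piecewise linear interpolation of `expMean α β` at the points
`k / 2 ^ n`. -/
noncomputable def dyadicInterp (n : ℕ) (ν α β : ℝ) : ℝ :=
  (1 - Int.fract ((2:ℝ)^n * ν)) * expMean α β (⌊(2:ℝ)^n * ν⌋ / 2^n)
    + Int.fract ((2:ℝ)^n * ν) * expMean α β ((⌊(2:ℝ)^n * ν⌋ + 1) / 2^n)

lemma expMean_le_dyadicInterp (n : ℕ) (ν α β : ℝ) :
    expMean α β ν ≤ dyadicInterp n ν α β := by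
  have h := convexOn_exp.2 (Set.mem_univ ((⌊(2:ℝ)^n * ν⌋ / 2^n : ℝ) * α
      + (1 - (⌊(2:ℝ)^n * ν⌋ / 2^n : ℝ)) * β))
    (Set.mem_univ (((⌊(2:ℝ)^n * ν⌋ + 1) / 2^n : ℝ) * α
      + (1 - ((⌊(2:ℝ)^n * ν⌋ + 1) / 2^n : ℝ)) * β))
    (sub_nonneg.2 (Int.fract_lt_one ((2:ℝ)^n * ν)).le)
    (Int.fract_nonneg ((2:ℝ)^n * ν)) (by ring)
  simp only [smul_eq_mul] at h
  refine le_trans (le_of_eq ?_) h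
  unfold expMean
  congr 1
  have h2 : (2:ℝ)^n ≠ 0 := by positivity
  rw [← Int.self_sub_floor]
  field_simp
  ring

lemma dyadicInterp_zero {ν : ℝ} (h0 : 0 ≤ ν) (h1 : ν ≤ 1) (α β : ℝ) :
    dyadicInterp 0 ν α β = ν * exp α + (1 - ν) * exp β := by
  rcases h1.lt_or_eq with h | rfl
  · have hf : ⌊ν⌋ = 0 := Int.floor_eq_zero_iff.2 ⟨h0, h⟩
    have hr : Int.fract ν = ν := Int.fract_eq_self.2 ⟨h0, h⟩
    simp [dyadicInterp, expMean, hf, hr]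
    ring
  · simp [dyadicInterp, expMean]

lemma sj_of_fract_lt {n : ℕ} {ν : ℝ} (h : Int.fract ((2:ℝ)^n * ν) < 1/2) :
    ⌊(2:ℝ)^(n+1) * ν⌋ = 2 * ⌊(2:ℝ)^n * ν⌋ ∧ sj (n+1) ν = Int.fract ((2:ℝ)^n * ν) := by
  have h0 := Int.fract_nonneg ((2:ℝ)^n * ν)
  have hs := Int.self_sub_floor ((2:ℝ)^n * ν)
  have hr : ⌊(2:ℝ)^(n+1) * ν⌋ = 2 * ⌊(2:ℝ)^n * ν⌋ := by
    rw [Int.floor_eq_iff, pow_succ]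
    push_cast
    constructor <;> linarith
  refine ⟨hr, ?_⟩
  have hfl : ⌊(((2 * ⌊(2:ℝ)^n * ν⌋ : ℤ) : ℝ) + 1) / 2⌋ = ⌊(2:ℝ)^n * ν⌋ := by
    rw [Int.floor_eq_iff]
    push_cast
    constructor <;> linarith
  rw [sj, rj, hr, hfl, Even.neg_one_zpow (even_two_mul _),
    Odd.neg_one_zpow (even_two_mul _).add_one, Nat.add_sub_cancel]
  linarith

lemma sj_of_le_fract {n : ℕ} {ν : ℝ} (h : 1/2 ≤ Int.fract ((2:ℝ)^n * ν)) :
    ⌊(2:ℝ)^(n+1) * ν⌋ = 2 * ⌊(2:ℝ)^n * ν⌋ + 1 ∧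
      sj (n+1) ν = 1 - Int.fract ((2:ℝ)^n * ν) := by
  have h0 := Int.fract_lt_one ((2:ℝ)^n * ν)
  have hs := Int.self_sub_floor ((2:ℝ)^n * ν)
  have hr : ⌊(2:ℝ)^(n+1) * ν⌋ = 2 * ⌊(2:ℝ)^n * ν⌋ + 1 := by
    rw [Int.floor_eq_iff, pow_succ]
    push_cast
    constructor <;> linarith
  refine ⟨hr, ?_⟩
  have hfl : ⌊(((2 * ⌊(2:ℝ)^n * ν⌋ + 1 : ℤ) : ℝ) + 1) / 2⌋ = ⌊(2:ℝ)^n * ν⌋ + 1 := by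
    rw [Int.floor_eq_iff]
    push_cast
    constructor <;> linarith
  rw [sj, rj, hr, hfl, Odd.neg_one_zpow (even_two_mul _).add_one,
    Even.neg_one_zpow (even_two_mul _).add_one.add_one, Nat.add_sub_cancel]
  push_cast
  linarith

lemma dyadicInterp_succ (n : ℕ) (ν α β : ℝ) :
    sj (n+1) ν * (expMean α β (⌊(2:ℝ)^n * ν⌋ / 2^n)
        - 2 * expMean α β ((2 * ⌊(2:ℝ)^n * ν⌋ + 1) / 2^(n+1))
        + expMean α β ((⌊(2:ℝ)^n * ν⌋ + 1) / 2^n))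
      + dyadicInterp (n+1) ν α β = dyadicInterp n ν α β := by
  have hs := Int.self_sub_floor ((2:ℝ)^n * ν)
  have h2 : (2:ℝ)^n ≠ 0 := by positivity
  rcases lt_or_ge (Int.fract ((2:ℝ)^n * ν)) (1/2) with h | h
  · obtain ⟨hr, hsj⟩ := sj_of_fract_lt h
    have hf : Int.fract ((2:ℝ)^(n+1) * ν) = 2 * Int.fract ((2:ℝ)^n * ν) := by
      rw [← Int.self_sub_floor, hr, pow_succ]
      push_cast
      linarith
    have hk : (2 * (⌊(2:ℝ)^n * ν⌋ : ℝ)) / 2^(n+1) = ⌊(2:ℝ)^n * ν⌋ / 2^n := by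
      rw [pow_succ]
      field_simp
    rw [dyadicInterp, dyadicInterp, hf, hsj, hr]
    push_cast
    rw [hk]
    ring
  · obtain ⟨hr, hsj⟩ := sj_of_le_fract h
    have hf : Int.fract ((2:ℝ)^(n+1) * ν) = 2 * Int.fract ((2:ℝ)^n * ν) - 1 := by
      rw [← Int.self_sub_floor, hr, pow_succ]
      push_cast
      linarith
    have hk : (2 * (⌊(2:ℝ)^n * ν⌋ : ℝ) + 1 + 1) / 2^(n+1) = (⌊(2:ℝ)^n * ν⌋ + 1) / 2^n := by
      rw [pow_succ]
      field_simp
      ring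
    rw [dyadicInterp, dyadicInterp, hf, hsj, hr]
    push_cast
    rw [hk]
    ring

lemma sq_sub_eq_expMean (n : ℕ) (k α β : ℝ) :
    ((exp β ^ ((2:ℝ)^n - k) * exp α ^ k) ^ ((1:ℝ)/2^(n+1))
      - (exp α ^ (k + 1) * exp β ^ ((2:ℝ)^n - k - 1)) ^ ((1:ℝ)/2^(n+1)))^2
      = expMean α β (k / 2^n) - 2 * expMean α β ((2 * k + 1) / 2^(n+1))
        + expMean α β ((k + 1) / 2^n) := by
  have h2 : (2:ℝ)^n ≠ 0 := by positivity
  simp only [← exp_mul, ← exp_add, expMean]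
  rw [sub_sq, mul_assoc, ← exp_add, ← exp_nat_mul, ← exp_nat_mul, pow_succ]
  congr 3
  · push_cast
    field_simp
    ring
  · congr 1
    field_simp
    ring
  · push_cast
    field_simp
    ring

lemma SS_add_dyadicInterp (N : ℕ) (ν α β : ℝ) :
    SS N ν (exp α) (exp β) + dyadicInterp N ν α β = dyadicInterp 0 ν α β := by
  induction N with
  | zero => simp [SS]
  | succ n ih =>
    rw [← ih, SS, Finset.sum_Icc_succ_top (by omega), ← SS, ← dyadicInterp_succ n,
      Nat.add_sub_cancel, sq_sub_eq_expMean, kj, Nat.add_sub_cancel, add_assoc]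

/-- The multiple-term refinement of Young's inequality. -/
lemma SS_add_rpow_mul_rpow_le {a b ν : ℝ} (ha : 0 < a) (hb : 0 < b) (N : ℕ) (h0 : 0 ≤ ν)
    (h1 : ν ≤ 1) : SS N ν a b + a ^ ν * b ^ (1 - ν) ≤ ν * a + (1 - ν) * b := by
  have h := SS_add_dyadicInterp N ν (log a) (log b)
  have h' := expMean_le_dyadicInterp N ν (log a) (log b)
  rw [dyadicInterp_zero h0 h1, exp_log ha, exp_log hb] at h
  rw [rpow_def_of_pos ha, rpow_def_of_pos hb, ← exp_add, mul_comm (log a), mul_comm (log b)]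
  rw [expMean] at h'
  linarith

theorem stmt4 (a b ν : ℝ) (ha : 0 < a) (hb : 0 < b) (N : ℕ) (h0 : 0 ≤ ν) (h1 : ν ≤ 1) :
    (1 + ν) * a - ν * b + (1/b) * SS N (1 - ν) (a * b) (b^2) ≤ a ^ (ν + 1) * b ^ (-ν) := by
  have h := SS_add_rpow_mul_rpow_le (mul_pos ha hb) (pow_pos hb 2) N
    (sub_nonneg.2 h1) (sub_le_self 1 h0)
  rw [sub_sub_cancel] at h
  set t := (a / b) ^ ν with ht
  have htpos : 0 < t := rpow_pos_of_pos (div_pos ha hb) ν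
  have hupper : a ^ (ν + 1) * b ^ (-ν) = a * t := by
    rw [ht, div_rpow ha.le hb.le, rpow_add ha, rpow_neg hb.le, rpow_one]
    ring
  have hlower : (a * b) ^ (1 - ν) * (b ^ 2) ^ ν = a * b * t⁻¹ := by
    have hbν := (rpow_pos_of_pos hb ν).ne'
    have haν := (rpow_pos_of_pos ha ν).ne'
    rw [ht, div_rpow ha.le hb.le, rpow_sub (mul_pos ha hb), rpow_one, mul_rpow ha.le hb.le,
      sq, mul_rpow hb.le hb.le]
    field_simp
  have hamgm : 2 ≤ t + t⁻¹ := by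
    have : t + t⁻¹ - 2 = (t - 1) ^ 2 / t := by
      field_simp
      ring
    have : 0 ≤ (t - 1) ^ 2 / t := by positivity
    linarith
  rw [hlower] at h
  have hS : (1/b) * SS N (1 - ν) (a * b) (b^2) ≤ (1 - ν) * a + ν * b - a * t⁻¹ := by
    rw [one_div, inv_mul_le_iff₀ hb]
    linarith
  rw [hupper]
  nlinarith [mul_le_mul_of_nonneg_left hamgm ha.le]
end

section
/- Let a, b > 0 and N, M ∈ ℕ. If 0 ≤ ν ≤ 1/2, then ν a + (1−ν) b + S_N(2ν; √(ab), a) + S_M( α_N(2ν); x_N(2ν; √(ab), a), y_N(2ν; √(ab), a) ) ≤ a^ν b^{1−ν} + (1−ν)(√a − √b)². If 1/2 ≤ ν ≤ 1, then ν a + (1−ν) b + S_N(2−2ν; √(ab), b) + S_M( α_N(2−2ν); x_N(2−2ν; √(ab), b), y_N(2−2ν; √(ab), b) ) ≤ a^ν b^{1−ν} + ν(√a − √b)². -/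
open Real Finset

noncomputable def alphaN (N : ℕ) (ν : ℝ) : ℝ := (⌊(2:ℝ)^N * ν⌋ : ℝ) + 1 - (2:ℝ)^N * ν

noncomputable def xN (N : ℕ) (ν a b : ℝ) : ℝ :=
  (a ^ ((⌊(2:ℝ)^N * ν⌋ : ℝ)) * b ^ ((2:ℝ)^N - (⌊(2:ℝ)^N * ν⌋ : ℝ))) ^ ((1:ℝ)/2^N)

noncomputable def yN (N : ℕ) (ν a b : ℝ) : ℝ :=
  (a ^ ((⌊(2:ℝ)^N * ν⌋ : ℝ) + 1) * b ^ ((2:ℝ)^N - (⌊(2:ℝ)^N * ν⌋ : ℝ) - 1)) ^ ((1:ℝ)/2^N)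

theorem alphaN_pos (N : ℕ) (ν : ℝ) : 0 < alphaN N ν := by
  unfold alphaN
  linarith [Int.lt_floor_add_one ((2:ℝ)^N * ν)]

theorem alphaN_le_one (N : ℕ) (ν : ℝ) : alphaN N ν ≤ 1 := by
  unfold alphaN
  linarith [Int.floor_le ((2:ℝ)^N * ν)]

theorem xN_pos (N : ℕ) (ν : ℝ) {a b : ℝ} (ha : 0 < a) (hb : 0 < b) : 0 < xN N ν a b := by
  unfold xN
  positivity

theorem yN_pos (N : ℕ) (ν : ℝ) {a b : ℝ} (ha : 0 < a) (hb : 0 < b) : 0 < yN N ν a b := by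
  unfold yN
  positivity

theorem rpow_mul_rpow_rpow_eq_exp {a b : ℝ} (ha : 0 < a) (hb : 0 < b) (c d e : ℝ) :
    (a ^ c * b ^ d) ^ e = exp ((log a * c + log b * d) * e) := by
  rw [rpow_def_of_pos ha, rpow_def_of_pos hb, ← exp_add, ← exp_mul]

theorem xN_rpow_mul_yN_rpow (N : ℕ) (ν : ℝ) {a b : ℝ} (ha : 0 < a) (hb : 0 < b) :
    xN N ν a b ^ alphaN N ν * yN N ν a b ^ (1 - alphaN N ν) = a ^ ν * b ^ (1 - ν) := by
  unfold xN yN alphaN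
  rw [rpow_mul_rpow_rpow_eq_exp ha hb, rpow_mul_rpow_rpow_eq_exp ha hb, ← exp_mul, ← exp_mul,
    rpow_def_of_pos ha, rpow_def_of_pos hb, ← exp_add, ← exp_add]
  congr 1
  field_simp
  ring

/-- The linear interpolant between consecutive dyadic points loses exactly one summand of `SS`
when the dyadic grid is refined. -/
theorem interpolant_succ (N : ℕ) (ν : ℝ) {a b : ℝ} (ha : 0 < a) (hb : 0 < b) :
    alphaN (N + 1) ν * xN (N + 1) ν a b + (1 - alphaN (N + 1) ν) * yN (N + 1) ν a b
      = alphaN N ν * xN N ν a b + (1 - alphaN N ν) * yN N ν a b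
        - sj (N + 1) ν *
          ((b ^ ((2:ℝ)^N - (kj (N + 1) ν : ℝ)) * a ^ ((kj (N + 1) ν : ℝ))) ^ ((1:ℝ)/2^(N + 1))
            - (a ^ ((kj (N + 1) ν : ℝ) + 1) * b ^ ((2:ℝ)^N - (kj (N + 1) ν : ℝ) - 1))
              ^ ((1:ℝ)/2^(N + 1)))^2 := by
  have hkj : kj (N + 1) ν = ⌊(2:ℝ)^N * ν⌋ := by simp [kj]
  have hrj : rj (N + 1) ν = ⌊(2:ℝ)^(N + 1) * ν⌋ := rfl
  have hs : sj (N + 1) ν = (-1:ℝ)^(rj (N + 1) ν) * (2:ℝ)^N * ν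
      + (-1:ℝ)^(rj (N + 1) ν + 1) * (⌊((rj (N + 1) ν : ℝ) + 1)/2⌋ : ℤ) := by simp [sj]
  rw [hs, hkj, hrj]
  unfold alphaN xN yN
  have hk := Int.floor_le ((2:ℝ)^N * ν)
  have hk' := Int.lt_floor_add_one ((2:ℝ)^N * ν)
  generalize ⌊(2:ℝ)^N * ν⌋ = k at hk hk' ⊢
  set u := (b ^ ((2:ℝ)^N - (k : ℝ)) * a ^ (k : ℝ)) ^ ((1:ℝ)/2^(N + 1)) with hu
  set v := (a ^ ((k : ℝ) + 1) * b ^ ((2:ℝ)^N - (k : ℝ) - 1)) ^ ((1:ℝ)/2^(N + 1)) with hv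
  have hx : (a ^ (k : ℝ) * b ^ ((2:ℝ)^N - (k : ℝ))) ^ ((1:ℝ)/2^N) = u * u := by
    rw [hu, rpow_mul_rpow_rpow_eq_exp ha hb, rpow_mul_rpow_rpow_eq_exp hb ha, ← exp_add]
    congr 1
    field_simp
    ring
  have hy : (a ^ ((k : ℝ) + 1) * b ^ ((2:ℝ)^N - (k : ℝ) - 1)) ^ ((1:ℝ)/2^N) = v * v := by
    rw [hv, rpow_mul_rpow_rpow_eq_exp ha hb, rpow_mul_rpow_rpow_eq_exp ha hb, ← exp_add]
    congr 1
    field_simp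
    ring
  have hm : (a ^ (2 * (k : ℝ) + 1) * b ^ ((2:ℝ)^(N + 1) - (2 * (k : ℝ) + 1))) ^ ((1:ℝ)/2^(N + 1))
      = u * v := by
    rw [hu, hv, rpow_mul_rpow_rpow_eq_exp ha hb, rpow_mul_rpow_rpow_eq_exp hb ha,
      rpow_mul_rpow_rpow_eq_exp ha hb, ← exp_add]
    congr 1
    field_simp
    ring
  rw [hx, hy]
  rcases lt_or_ge ((2:ℝ)^N * ν) (k + 1 / 2) with h | h
  · have hr : ⌊(2:ℝ)^(N + 1) * ν⌋ = 2 * k := by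
      rw [Int.floor_eq_iff, pow_succ]
      push_cast
      constructor <;> linarith
    have hf : ⌊(((2 * k : ℤ) : ℝ) + 1)/2⌋ = k := by
      rw [Int.floor_eq_iff]
      push_cast
      constructor <;> linarith
    have hx' : (a ^ (2 * (k : ℝ)) * b ^ ((2:ℝ)^(N + 1) - 2 * (k : ℝ))) ^ ((1:ℝ)/2^(N + 1))
        = u * u := by
      rw [← hx, rpow_mul_rpow_rpow_eq_exp ha hb, rpow_mul_rpow_rpow_eq_exp ha hb]
      congr 1
      field_simp
      ring
    have he : (-1:ℝ)^(2 * k) = 1 := (even_two_mul k).neg_one_zpow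
    rw [hr, hf, zpow_add₀ (by norm_num), he]
    push_cast
    rw [hx', sub_sub, hm]
    ring
  · have hr : ⌊(2:ℝ)^(N + 1) * ν⌋ = 2 * k + 1 := by
      rw [Int.floor_eq_iff, pow_succ]
      push_cast
      constructor <;> linarith
    have hf : ⌊(((2 * k + 1 : ℤ) : ℝ) + 1)/2⌋ = k + 1 := by
      rw [Int.floor_eq_iff]
      push_cast
      constructor <;> linarith
    have hy' : (a ^ (2 * (k : ℝ) + 1 + 1) * b ^ ((2:ℝ)^(N + 1) - (2 * (k : ℝ) + 1) - 1))
        ^ ((1:ℝ)/2^(N + 1)) = v * v := by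
      rw [← hy, rpow_mul_rpow_rpow_eq_exp ha hb, rpow_mul_rpow_rpow_eq_exp ha hb]
      congr 1
      field_simp
      ring
    have he : (-1:ℝ)^(2 * k + 1) = -1 := (odd_two_mul_add_one k).neg_one_zpow
    rw [hr, hf, zpow_add₀ (by norm_num) (2 * k + 1), he]
    push_cast
    rw [hm, hy']
    ring

theorem SS_add_interpolant (N : ℕ) {ν a b : ℝ} (ha : 0 < a) (hb : 0 < b)
    (h0 : 0 ≤ ν) (h1 : ν ≤ 1) :
    SS N ν a b + (alphaN N ν * xN N ν a b + (1 - alphaN N ν) * yN N ν a b)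
      = ν * a + (1 - ν) * b := by
  induction N with
  | zero =>
    rcases h1.lt_or_eq with h | rfl
    · have hf : ⌊ν⌋ = 0 := Int.floor_eq_zero_iff.2 ⟨h0, h⟩
      simp [SS, alphaN, xN, yN, hf]
      ring
    · simp [SS, alphaN, xN, yN]
  | succ N ih =>
    have hS := Finset.sum_Icc_succ_top (Nat.le_add_left 1 N) fun j => sj j ν *
      ((b ^ ((2:ℝ)^(j-1) - (kj j ν : ℝ)) * a ^ ((kj j ν : ℝ))) ^ ((1:ℝ)/2^j)
        - (a ^ ((kj j ν : ℝ) + 1) * b ^ ((2:ℝ)^(j-1) - (kj j ν : ℝ) - 1)) ^ ((1:ℝ)/2^j))^2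
    simp only [Nat.add_sub_cancel] at hS
    rw [interpolant_succ N ν ha hb, ← ih]
    unfold SS
    rw [hS]
    ring

theorem rpow_mul_rpow_add_SS_le (M : ℕ) {ν a b : ℝ} (ha : 0 < a) (hb : 0 < b)
    (h0 : 0 ≤ ν) (h1 : ν ≤ 1) :
    a ^ ν * b ^ (1 - ν) + SS M ν a b ≤ ν * a + (1 - ν) * b := by
  have h := Real.geom_mean_le_arith_mean2_weighted (alphaN_pos M ν).le
    (sub_nonneg.2 (alphaN_le_one M ν)) (xN_pos M ν ha hb).le (yN_pos M ν ha hb).le (by ring)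
  rw [xN_rpow_mul_yN_rpow M ν ha hb] at h
  linarith [SS_add_interpolant M ha hb h0 h1]

theorem rpow_mul_rpow_add_SS_add_SS_le (N M : ℕ) {ν a b : ℝ} (ha : 0 < a) (hb : 0 < b)
    (h0 : 0 ≤ ν) (h1 : ν ≤ 1) :
    a ^ ν * b ^ (1 - ν) + SS N ν a b + SS M (alphaN N ν) (xN N ν a b) (yN N ν a b)
      ≤ ν * a + (1 - ν) * b := by
  have h := rpow_mul_rpow_add_SS_le M (xN_pos N ν ha hb) (yN_pos N ν ha hb)
    (alphaN_pos N ν).le (alphaN_le_one N ν)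
  rw [xN_rpow_mul_yN_rpow N ν ha hb] at h
  linarith [SS_add_interpolant N ha hb h0 h1]

theorem add_SS_add_SS_le_of_le_half (N M : ℕ) {ν a b : ℝ} (ha : 0 < a) (hb : 0 < b)
    (h0 : 0 ≤ ν) (h1 : ν ≤ 1 / 2) :
    ν * a + (1 - ν) * b + SS N (2 * ν) (√(a * b)) a
        + SS M (alphaN N (2 * ν)) (xN N (2 * ν) (√(a * b)) a) (yN N (2 * ν) (√(a * b)) a)
      ≤ a ^ ν * b ^ (1 - ν) + (1 - ν) * (√a - √b)^2 := by
  have hab : 0 < a * b := mul_pos ha hb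
  have h := rpow_mul_rpow_add_SS_add_SS_le N M (sqrt_pos.2 hab) ha
    (show 0 ≤ 2 * ν by linarith) (by linarith)
  have hsq : (√a - √b)^2 = a + b - 2 * √(a * b) := by
    rw [sub_sq, sq_sqrt ha.le, sq_sqrt hb.le, sqrt_mul ha.le]
    ring
  have hpow : √(a * b) ^ (2 * ν) * a ^ (1 - 2 * ν) = a ^ (1 - ν) * b ^ ν := by
    rw [sqrt_eq_rpow, ← rpow_mul hab.le, mul_rpow ha.le hb.le, mul_right_comm, ← rpow_add ha]
    ring_nf
  have hprod : (a ^ ν * b ^ (1 - ν)) * (a ^ (1 - ν) * b ^ ν) = √(a * b) ^ 2 := by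
    rw [sq_sqrt hab.le, mul_mul_mul_comm, ← rpow_add ha, ← rpow_add hb]
    simp
  have hamgm : 2 * √(a * b) ≤ a ^ ν * b ^ (1 - ν) + a ^ (1 - ν) * b ^ ν := by
    have hu : 0 < a ^ ν * b ^ (1 - ν) := by positivity
    have hv : 0 < a ^ (1 - ν) * b ^ ν := by positivity
    refine abs_le_of_sq_le_sq' ?_ (by positivity) |>.2
    nlinarith [sq_nonneg (a ^ ν * b ^ (1 - ν) - a ^ (1 - ν) * b ^ ν)]
  rw [hpow] at h
  rw [hsq]
  linarith

theorem stmt10 (a b ν : ℝ) (ha : 0 < a) (hb : 0 < b) (N M : ℕ) :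
    (0 ≤ ν → ν ≤ 1/2 →
      ν * a + (1 - ν) * b + SS N (2 * ν) (Real.sqrt (a * b)) a
        + SS M (alphaN N (2 * ν)) (xN N (2 * ν) (Real.sqrt (a * b)) a)
            (yN N (2 * ν) (Real.sqrt (a * b)) a)
        ≤ a ^ ν * b ^ (1 - ν) + (1 - ν) * (Real.sqrt a - Real.sqrt b)^2) ∧
    (1/2 ≤ ν → ν ≤ 1 →
      ν * a + (1 - ν) * b + SS N (2 - 2 * ν) (Real.sqrt (a * b)) b
        + SS M (alphaN N (2 - 2 * ν)) (xN N (2 - 2 * ν) (Real.sqrt (a * b)) b)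
            (yN N (2 - 2 * ν) (Real.sqrt (a * b)) b)
        ≤ a ^ ν * b ^ (1 - ν) + ν * (Real.sqrt a - Real.sqrt b)^2) := by
  refine ⟨add_SS_add_SS_le_of_le_half N M ha hb, fun h0 h1 => ?_⟩
  have h := add_SS_add_SS_le_of_le_half N M hb ha (show 0 ≤ 1 - ν by linarith) (by linarith)
  rw [mul_comm b a, show 2 * (1 - ν) = 2 - 2 * ν by ring, sub_sub_cancel, sub_sq_comm,
    mul_comm (b ^ (1 - ν))] at h
  linarith
end
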